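/- There exists an absolute constant λ > 0 such that: if P(x) = ((⋯(x^2 - c_1)^2 ⋯)^2 - c_k ∈ ℤ[x] splits into linear factors over ℤ and c_k ≠ 0, then for all j with 3 ≤ j ≤ k, ln(c_j) > λ · j · 2^j. -/

import Mathlib

open Polynomial

noncomputable def chain (c : ℕ → ℤ) : ℕ → Polynomial ℤ
  | 0 => X
  | j + 1 => (chain c j) ^ 2 - C (c (j + 1))

def Crumbles (P : Polynomial ℤ) : Prop :=
  ∃ s : Multiset (Polynomial ℤ), (∀ q ∈ s, q.degree = 1) ∧ P = s.prod

/-- Newton's identities: if the elementary symmetric functions of two tuples agree below degree `n`,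
then so do their power sums, and the difference in degree `n` is known. -/
theorem psum_sub_psum {σ R : Type*} [Fintype σ] [CommRing R] (f g : σ → R) (n : ℕ)
    (h : ∀ m < n, MvPolynomial.aeval f (MvPolynomial.esymm σ R m) =
      MvPolynomial.aeval g (MvPolynomial.esymm σ R m)) (k : ℕ) (hk : k ≤ n) :
    ∑ i, f i ^ k - ∑ i, g i ^ k = (-1) ^ (k + 1) * k *
      (MvPolynomial.aeval f (MvPolynomial.esymm σ R k) -
        MvPolynomial.aeval g (MvPolynomial.esymm σ R k)) := by
  induction k using Nat.strong_induction_on with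
  | _ k ih =>
  rcases Nat.eq_zero_or_pos k with rfl | hk0
  · simp
  have key (f : σ → R) := congrArg (MvPolynomial.aeval f)
    (MvPolynomial.psum_eq_mul_esymm_sub_sum σ R k hk0)
  simp only [MvPolynomial.psum, map_sub, map_sum, map_mul, map_pow, MvPolynomial.aeval_X, map_neg,
    map_one, map_natCast] at key
  rw [key f, key g]
  have hsum : ∀ a ∈ (Finset.HasAntidiagonal.antidiagonal k).filter (fun a => a.1 ∈ Set.Ioo 0 k),
      (-1) ^ a.1 * MvPolynomial.aeval f (MvPolynomial.esymm σ R a.1) * ∑ i, f i ^ a.2 =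
      (-1) ^ a.1 * MvPolynomial.aeval g (MvPolynomial.esymm σ R a.1) * ∑ i, g i ^ a.2 := by
    intro a ha
    simp only [Finset.mem_filter, Finset.HasAntidiagonal.mem_antidiagonal, Set.mem_Ioo] at ha
    have h2 := ih a.2 (by omega) (by omega)
    rw [h a.2 (by omega), sub_self, mul_zero, sub_eq_zero] at h2
    rw [h a.1 (by omega), h2]
  rw [Finset.sum_congr rfl hsum]
  ring

theorem exists_fin_map_eq {α : Type*} (s : Multiset α) {n : ℕ} (hn : s.card = n) :
    ∃ f : Fin n → α, Finset.univ.val.map f = s := by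
  subst hn
  obtain ⟨l, rfl⟩ := Quot.exists_rep s
  exact ⟨l.get, (Fin.univ_val_map l.get).trans (congrArg _ (List.ofFn_get l))⟩

theorem factorial_dvd_descPochhammer_eval (n : ℕ) (r : ℤ) :
    (n.factorial : ℤ) ∣ (descPochhammer ℤ n).eval r := by
  have h := Ring.descPochhammer_eq_factorial_smul_choose r n
  rw [← eval_eq_smeval, nsmul_eq_mul] at h
  exact ⟨_, h⟩

/-- A constant separating two products of `n` monic integral linear factors is divisible by
`(n - 1)!`. -/
theorem factorial_dvd_of_splits {P Q : ℤ[X]} (hP : P.Splits) (hQ : Q.Splits) (hPm : P.Monic)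
    (hQm : Q.Monic) {n : ℕ} (hPn : P.natDegree = n + 1) (hQn : Q.natDegree = n + 1) {d : ℤ}
    (h : P - Q = C d) : (n.factorial : ℤ) ∣ d := by
  obtain ⟨f, hf⟩ := exists_fin_map_eq P.roots (hP.natDegree_eq_card_roots.symm.trans hPn)
  obtain ⟨g, hg⟩ := exists_fin_map_eq Q.roots (hQ.natDegree_eq_card_roots.symm.trans hQn)
  have coeffs {P : ℤ[X]} (hP : P.Splits) (hPm : P.Monic) (hPn : P.natDegree = n + 1)
      {f : Fin (n + 1) → ℤ} (hf : Finset.univ.val.map f = P.roots) (m : ℕ) (hm : m ≤ n + 1) :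
      MvPolynomial.aeval f (MvPolynomial.esymm (Fin (n + 1)) ℤ m) =
        (-1) ^ m * P.coeff (n + 1 - m) := by
    have h1 := coeff_eq_esymm_roots_of_card (p := P) hP.natDegree_eq_card_roots.symm
      (k := n + 1 - m) (by omega)
    rw [MvPolynomial.aeval_esymm_eq_multiset_esymm, hf, h1, hPm.leadingCoeff, hPn,
      Nat.sub_sub_self hm, one_mul, ← mul_assoc, ← mul_pow]
    simp
  have hc (m : ℕ) : P.coeff m - Q.coeff m = if m = 0 then d else 0 := by
    rw [← coeff_sub, h, coeff_C]
  have hlow : ∀ m < n + 1, MvPolynomial.aeval f (MvPolynomial.esymm (Fin (n + 1)) ℤ m) =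
      MvPolynomial.aeval g (MvPolynomial.esymm (Fin (n + 1)) ℤ m) := by
    intro m hm
    have := hc (n + 1 - m)
    rw [if_neg (by omega)] at this
    rw [coeffs hP hPm hPn hf m hm.le, coeffs hQ hQm hQn hg m hm.le, sub_eq_zero.1 this]
  have htop : ∑ i, f i ^ (n + 1) - ∑ i, g i ^ (n + 1) = -((n + 1 : ℕ) * d) := by
    have h0 := hc 0
    rw [if_pos rfl] at h0
    rw [psum_sub_psum f g (n + 1) hlow (n + 1) le_rfl, coeffs hP hPm hPn hf _ le_rfl,
      coeffs hQ hQm hQn hg _ le_rfl, Nat.sub_self, ← mul_sub, h0]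
    have : ((-1 : ℤ) ^ (n + 1)) * (-1) ^ (n + 1) = 1 := by rw [← mul_pow]; simp
    linear_combination (-((n + 1 : ℕ) : ℤ) * d) * this
  have hsum : ∑ i, (descPochhammer ℤ (n + 1)).eval (f i) -
      ∑ i, (descPochhammer ℤ (n + 1)).eval (g i) = -((n + 1 : ℕ) * d) := by
    simp only [eval_eq_sum_range, descPochhammer_natDegree]
    rw [Finset.sum_comm, Finset.sum_comm (s := Finset.univ (α := Fin (n + 1))),
      ← Finset.sum_sub_distrib, Finset.sum_range_succ, Finset.sum_eq_zero]
    · have hl := (monic_descPochhammer ℤ (n + 1)).coeff_natDegree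
      rw [descPochhammer_natDegree] at hl
      simpa [hl] using htop
    · intro m hm
      have hm' := Finset.mem_range.1 hm
      have := psum_sub_psum f g (n + 1) hlow m hm'.le
      rw [hlow m hm', sub_self, mul_zero] at this
      rw [← Finset.mul_sum, ← Finset.mul_sum, ← mul_sub, this, mul_zero]
  have hdvd : ((n + 1).factorial : ℤ) ∣ (n + 1 : ℕ) * d := by
    rw [← dvd_neg, ← hsum]
    exact dvd_sub (Finset.dvd_sum fun i _ => factorial_dvd_descPochhammer_eval _ _)
      (Finset.dvd_sum fun i _ => factorial_dvd_descPochhammer_eval _ _)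
  rw [Nat.factorial_succ, Nat.cast_mul] at hdvd
  exact Int.dvd_of_mul_dvd_mul_left (by positivity) hdvd

theorem chain_monic_natDegree (c : ℕ → ℤ) (j : ℕ) :
    (chain c j).Monic ∧ (chain c j).natDegree = 2 ^ j := by
  induction j with
  | zero => exact ⟨monic_X, natDegree_X⟩
  | succ j ih =>
    have hd : ((chain c j) ^ 2).natDegree = 2 ^ (j + 1) := by
      rw [ih.1.natDegree_pow, ih.2, pow_succ, mul_comm]
    refine ⟨(ih.1.pow 2).sub_of_left ?_, ?_⟩
    · exact degree_C_le.trans_lt (natDegree_pos_iff_degree_pos.1 (by rw [hd]; positivity))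
    · rw [chain, natDegree_sub_C, hd]

theorem Crumbles.splits {P : ℤ[X]} (h : Crumbles P) (hP : P.Monic) : P.Splits := by
  obtain ⟨s, hs, rfl⟩ := h
  refine Splits.multisetProd fun q hq => ?_
  have hu : IsUnit q.leadingCoeff :=
    isUnit_of_dvd_one (hP.leadingCoeff ▸ map_dvd leadingCoeffHom (Multiset.dvd_prod hq))
  obtain ⟨u, hu⟩ := hu
  exact Splits.of_degree_le_one_of_invertible (hs q hq).le (hu ▸ u.invertible)

/-- If `P ^ 2 - v` splits over `ℤ`, then `v` is a perfect square. -/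
theorem exists_sq_of_splits {P : ℤ[X]} (hP : P.Monic) (hd : 0 < P.natDegree) {v : ℤ}
    (h : (P ^ 2 - C v).Splits) :
    ∃ d : ℤ, 0 ≤ d ∧ v = d ^ 2 ∧ (P - C d).Splits ∧ (P + C d).Splits := by
  have hdeg : 0 < (P ^ 2 - C v).natDegree := by
    rw [natDegree_sub_C, hP.natDegree_pow]
    omega
  obtain ⟨x, hx⟩ := h.exists_eval_eq_zero (natDegree_pos_iff_degree_pos.1 hdeg).ne'
  have hv : v = |P.eval x| ^ 2 := by
    simp only [eval_sub, eval_pow, eval_C] at hx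
    rw [sq_abs]
    linarith
  have hfac : P ^ 2 - C v = (P - C |P.eval x|) * (P + C |P.eval x|) := by
    rw [hv, C_pow]
    ring
  have hne : P ^ 2 - C v ≠ 0 := ne_zero_of_natDegree_gt hdeg
  refine ⟨_, abs_nonneg _, hv, h.of_dvd hne ?_, h.of_dvd hne ?_⟩
  · exact hfac ▸ dvd_mul_right _ _
  · exact hfac ▸ dvd_mul_left _ _

/-- If a chain with `c (k + 1) ≠ 0` splits, then truncating it at any earlier stage and replacing the
last constant by a suitable nonzero `v ≤ 2 * c (j + 1)` also gives a chain that splits. -/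
theorem exists_splits_of_le {c : ℕ → ℤ} {k : ℕ} (h : (chain c (k + 1)).Splits)
    (hc : c (k + 1) ≠ 0) {j : ℕ} (hj : j ≤ k) :
    ∃ v : ℤ, v ≠ 0 ∧ v ≤ 2 * c (j + 1) ∧ (chain c j ^ 2 - C v).Splits := by
  have sq (j : ℕ) {v : ℤ} := exists_sq_of_splits (v := v) (chain_monic_natDegree c j).1
    (by rw [(chain_monic_natDegree c j).2]; positivity)
  refine Nat.decreasingInduction
    (motive := fun j _ => ∃ v : ℤ, v ≠ 0 ∧ v ≤ 2 * c (j + 1) ∧ (chain c j ^ 2 - C v).Splits)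
    ?_ ?_ hj
  · rintro i - ⟨v, hv, -, hs⟩
    obtain ⟨d, hd, rfl, h1, h2⟩ := sq (i + 1) hs
    have hd0 : d ≠ 0 := by rintro rfl; simp at hv
    have e1 : chain c (i + 1) - C d = chain c i ^ 2 - C (c (i + 1) + d) := by
      rw [chain, C_add]; ring
    have e2 : chain c (i + 1) + C d = chain c i ^ 2 - C (c (i + 1) - d) := by
      rw [chain, C_sub]; ring
    rw [e1] at h1
    rw [e2] at h2
    obtain ⟨e, -, he, -⟩ := sq i h2
    have := sq_nonneg e
    exact ⟨_, by lia, by lia, h1⟩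
  · obtain ⟨d, -, hd, -⟩ := sq k h
    exact ⟨_, hc, by nlinarith [sq_nonneg d], h⟩

theorem pow_self_le_factorial_sq (n : ℕ) : n ^ n ≤ n.factorial ^ 2 := by
  have h1 : n.factorial = ∏ i ∈ Finset.range n, (i + 1) :=
    (Finset.prod_range_add_one_eq_factorial n).symm
  have h2 : n.factorial = ∏ i ∈ Finset.range n, (n - i) := by
    rw [h1, ← Finset.prod_range_reflect]
    refine Finset.prod_congr rfl fun i hi => ?_
    have := Finset.mem_range.1 hi
    omega
  rw [sq]
  nth_rewrite 1 [h1]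
  rw [h2, ← Finset.prod_mul_distrib]
  calc n ^ n = ∏ _i ∈ Finset.range n, n := by simp
    _ ≤ _ := Finset.prod_le_prod' fun i hi => by
      obtain ⟨t, rfl⟩ := Nat.exists_eq_add_of_lt (Finset.mem_range.1 hi)
      rw [show i + t + 1 - i = t + 1 by omega]
      nlinarith [Nat.zero_le (i * t)]

theorem pow_self_le_of_splits {P : ℤ[X]} (hP : P.Monic) {n : ℕ} (hn : P.natDegree = n + 1) {v : ℤ}
    (hv : v ≠ 0) (h : (P ^ 2 - C v).Splits) : (n : ℤ) ^ n ≤ 4 * v := by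
  obtain ⟨d, hd, rfl, h1, h2⟩ := exists_sq_of_splits hP (by omega) h
  have hd0 : 0 < d := hd.lt_of_ne (by rintro rfl; simp at hv)
  have hC : ∀ a : ℤ, (C a).degree < P.degree := fun a =>
    degree_C_le.trans_lt (natDegree_pos_iff_degree_pos.1 (by omega))
  have hdvd := factorial_dvd_of_splits h2 h1 (hP.add_of_left (hC d)) (hP.sub_of_left (hC d))
    (n := n) (d := 2 * d) (by rw [natDegree_add_C, hn]) (by rw [natDegree_sub_C, hn])
    (by rw [two_mul, C_add]; ring)
  have hle := Int.le_of_dvd (by positivity) hdvd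
  calc (n : ℤ) ^ n ≤ (n.factorial : ℤ) ^ 2 := by exact_mod_cast pow_self_le_factorial_sq n
    _ ≤ (2 * d) ^ 2 := by gcongr
    _ = 4 * d ^ 2 := by ring

theorem mul_two_pow_lt_log {i : ℕ} (hi : 2 ≤ i) {x : ℝ}
    (hx : ((2 ^ i - 1 : ℕ) : ℝ) ^ (2 ^ i - 1) ≤ 8 * x) :
    1 / 100 * ((i + 1 : ℕ) : ℝ) * 2 ^ (i + 1) < Real.log x := by
  obtain ⟨m, rfl⟩ := Nat.exists_eq_add_of_le hi
  have hpow : (1 : ℕ) ≤ 2 ^ m := Nat.one_le_two_pow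
  obtain ⟨t, ht⟩ : ∃ t, 2 ^ (2 + m) - 1 = t + 2 := ⟨2 ^ (2 + m) - 3, by rw [pow_add]; omega⟩
  have ht' : t + 3 = 4 * 2 ^ m := by rw [pow_add] at ht; omega
  rw [ht] at hx
  have htm : 2 ^ m ≤ t := by omega
  have hbase : 2 ^ (m + 1) ≤ t + 2 := by rw [pow_succ]; omega
  have hbaseR : (2 : ℝ) ^ (m + 1) ≤ ((t + 2 : ℕ) : ℝ) := by exact_mod_cast hbase
  have h9 : (9 : ℝ) ≤ ((t + 2 : ℕ) : ℝ) ^ 2 := by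
    have : (3 : ℝ) ≤ ((t + 2 : ℕ) : ℝ) := by exact_mod_cast (by omega : 3 ≤ t + 2)
    nlinarith
  have hxt : ((t + 2 : ℕ) : ℝ) ^ t ≤ x := by
    have hp : 0 ≤ ((t + 2 : ℕ) : ℝ) ^ t := by positivity
    rw [pow_add] at hx
    nlinarith
  have hlog : (t : ℝ) * ((m + 1 : ℕ) * Real.log 2) ≤ Real.log x := by
    rw [← Real.log_pow, ← Real.log_pow]
    refine Real.log_le_log (by positivity) (le_trans ?_ hxt)
    gcongr
  have hl2 := Real.log_two_gt_d9
  have htR : (2 : ℝ) ^ m ≤ t := by exact_mod_cast htm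
  calc 1 / 100 * ((2 + m + 1 : ℕ) : ℝ) * 2 ^ (2 + m + 1)
      = 2 ^ m * (8 / 100 * ((m : ℝ) + 3)) := by push_cast; ring
    _ < 2 ^ m * (((m : ℝ) + 1) * (1 / 2)) := by
        refine mul_lt_mul_of_pos_left ?_ (by positivity)
        linarith [(Nat.cast_nonneg m : (0 : ℝ) ≤ m)]
    _ ≤ t * (((m + 1 : ℕ) : ℝ) * Real.log 2) := by
        push_cast
        gcongr
        linarith
    _ ≤ _ := hlog

theorem stmt_14 :
    ∃ lam : ℝ, 0 < lam ∧
      ∀ (k : ℕ) (c : ℕ → ℤ), Crumbles (chain c k) → c k ≠ 0 →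
        ∀ j, 3 ≤ j → j ≤ k → Real.log (c j) > lam * j * 2 ^ j := by
  refine ⟨1 / 100, by norm_num, fun k c h hc j hj hjk => ?_⟩
  obtain ⟨i, rfl⟩ := Nat.exists_eq_add_of_le' (show 1 ≤ j by omega)
  obtain ⟨l, rfl⟩ := Nat.exists_eq_add_of_le' (show 1 ≤ k by omega)
  obtain ⟨v, hv, hle, hs⟩ := exists_splits_of_le (h.splits (chain_monic_natDegree c _).1) hc
    (show i ≤ l by omega)
  obtain ⟨hm, hd⟩ := chain_monic_natDegree c i
  have hp := pow_self_le_of_splits hm (n := 2 ^ i - 1)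
    (by rw [hd, Nat.sub_add_cancel Nat.one_le_two_pow]) hv hs
  refine mul_two_pow_lt_log (by omega) ?_
  exact_mod_cast (show ((2 ^ i - 1 : ℕ) : ℤ) ^ (2 ^ i - 1) ≤ 8 * c (i + 1) by linarith)
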